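/- Let q > 1 be a real number and α₁ = ⌈q⌉ − 1. The map x ↦ (b_i(x)), assigning to each x ∈ [0, α₁/(q−1)] its greedy expansion in base q, is a strictly increasing bijection from [0, α₁/(q−1)] onto the set of all sequences (b_i)_{i≥1} with 0 ≤ b_n ≤ α₁ for all n ≥ 1 such that for every n ≥ 1 with b_n < α₁ the shifted sequence (b_{n+i})_{i≥1} is lexicographically strictly smaller than (α_i(q))_{i≥1}. Here strictly increasing means: x < y implies (b_i(x)) is lexicographically strictly smaller than (b_i(y)). -/

import Mathlib

open Classical

noncomputable section

/-- The largest digit in base `q`: `α₁ = ⌈q⌉ - 1`. -/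
def alphaOne (q : ℝ) : ℕ := (⌈q⌉ - 1).toNat

/-- `c` (0-indexed: `c i` is the digit `c_{i+1}` of the paper) is an expansion of `x`
in base `q`: all digits lie in `{0, …, α₁}` and `x = ∑_{i≥1} c_i q^{-i}`. -/
def IsExpansionOf (q x : ℝ) (c : ℕ → ℕ) : Prop :=
  (∀ i, c i ≤ alphaOne q) ∧ x = ∑' i, (c i : ℝ) / q ^ (i + 1)

/-- A sequence is called infinite if it has infinitely many nonzero terms. -/
def InfiniteSeq (c : ℕ → ℕ) : Prop := {i | c i ≠ 0}.Infinite

/-- Strict lexicographic order on sequences. -/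
def LexLt (a b : ℕ → ℕ) : Prop := ∃ n, (∀ i, i < n → a i = b i) ∧ a n < b n

/-- Lexicographic order `≤` on sequences. -/
def LexLe (a b : ℕ → ℕ) : Prop := LexLt a b ∨ a = b

/-- `b` is the greedy (lexicographically largest) expansion of `x` in base `q`. -/
def IsGreedyOf (q x : ℝ) (b : ℕ → ℕ) : Prop :=
  IsExpansionOf q x b ∧ ∀ c, IsExpansionOf q x c → LexLe c b

/-- `a` is the quasi-greedy (lexicographically largest infinite) expansion of `x`
in base `q`. -/
def IsQuasiGreedyOf (q x : ℝ) (a : ℕ → ℕ) : Prop :=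
  IsExpansionOf q x a ∧ InfiniteSeq a ∧
    ∀ c, IsExpansionOf q x c → InfiniteSeq c → LexLe c a

/-- The quasi-greedy expansion of `x` in base `q`; by convention it is the zero
sequence whenever no infinite expansion exists (in particular for `x = 0`). -/
def quasiGreedy (q x : ℝ) : ℕ → ℕ :=
  if h : ∃ a, IsQuasiGreedyOf q x a then h.choose else fun _ => 0

/-- The greedy expansion of `x` in base `q` (zero sequence if `x` has no expansion). -/
def greedy (q x : ℝ) : ℕ → ℕ :=
  if h : ∃ b, IsGreedyOf q x b then h.choose else fun _ => 0

/-- The interval `J_q = [0, α₁/(q-1)]`. -/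
def Jq (q : ℝ) : Set ℝ := Set.Icc 0 ((alphaOne q : ℝ) / (q - 1))

/-- `U_q`: the set of real numbers having exactly one expansion in base `q`. -/
def Uq (q : ℝ) : Set ℝ := {x | ∃! c, IsExpansionOf q x c}

/-- `U_q'`: the set of univoque sequences in base `q`. -/
def UqSeq (q : ℝ) : Set (ℕ → ℕ) := {c | ∃ x ∈ Uq q, IsExpansionOf q x c}

/-- `U`: the set of univoque numbers. -/
def USet : Set ℝ := {q | 1 < q ∧ ∃! c, IsExpansionOf q 1 c}

/-- `V_q`: the set of `x ∈ J_q` such that for every `n ≥ 1` with `a_n(x) > 0` the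
conjugated shifted quasi-greedy expansion is lexicographically at most `(α_i)`. -/
def Vq (q : ℝ) : Set ℝ :=
  {x | x ∈ Jq q ∧ ∀ n, 0 < quasiGreedy q x n →
    LexLe (fun i => alphaOne q - quasiGreedy q x (n + 1 + i)) (quasiGreedy q 1)}

/-- `V`: the set of `q > 1` whose quasi-greedy expansion `(α_i)` of `1` satisfies
`(α₁ - α_{k+i})_{i≥1} ≤ (α_i)_{i≥1}` lexicographically for all `k ≥ 1`. -/
def VSet : Set ℝ :=
  {q | 1 < q ∧ ∀ k, LexLe (fun i => alphaOne q - quasiGreedy q 1 (k + 1 + i)) (quasiGreedy q 1)}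

/-- The value `∑_{i≥1} c_i q^{-i}` of a digit sequence. -/
def seqValue (q : ℝ) (c : ℕ → ℕ) : ℝ := ∑' i, (c i : ℝ) / q ^ (i + 1)

/-- The sequence with its first `n` terms removed. -/
def shiftSeq (n : ℕ) (c : ℕ → ℕ) : ℕ → ℕ := fun i => c (n + i)

theorem shiftSeq_shiftSeq (m n : ℕ) (c : ℕ → ℕ) :
    shiftSeq m (shiftSeq n c) = shiftSeq (n + m) c := by
  funext i
  simp [shiftSeq, add_assoc]

theorem lexLt_trichotomy (a b : ℕ → ℕ) : LexLt a b ∨ a = b ∨ LexLt b a := by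
  by_cases h : ∃ n, a n ≠ b n
  · have hmin : ∀ i < Nat.find h, a i = b i := fun i hi => not_not.1 (Nat.find_min h hi)
    rcases lt_or_gt_of_ne (Nat.find_spec h) with hlt | hlt
    · exact Or.inl ⟨_, hmin, hlt⟩
    · exact Or.inr (Or.inr ⟨_, fun i hi => (hmin i hi).symm, hlt⟩)
  · push Not at h
    exact Or.inr (Or.inl (funext h))

theorem LexLt.asymm {a b : ℕ → ℕ} (hab : LexLt a b) (hba : LexLt b a) : False := by
  obtain ⟨m, hm, hmlt⟩ := hab
  obtain ⟨n, hn, hnlt⟩ := hba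
  rcases lt_trichotomy m n with h | h | h
  · have := hn m h
    omega
  · subst h
    omega
  · have := hm n h
    omega

theorem LexLe.antisymm {a b : ℕ → ℕ} (hab : LexLe a b) (hba : LexLe b a) : a = b := by
  rcases hab with hab | hab
  · rcases hba with hba | hba
    · exact (hab.asymm hba).elim
    · exact hba.symm
  · exact hab

section Digits

variable {q : ℝ}

theorem alphaOne_cast (hq : 1 < q) : (alphaOne q : ℝ) = ⌈q⌉ - 1 := by
  have h : (1 : ℤ) < ⌈q⌉ := Int.lt_ceil.2 (by simpa using hq)
  have h2 : ((alphaOne q : ℕ) : ℤ) = ⌈q⌉ - 1 := Int.toNat_of_nonneg (by omega)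
  exact_mod_cast congrArg (Int.cast (R := ℝ)) h2

theorem le_alphaOne_add_one (hq : 1 < q) : q ≤ alphaOne q + 1 := by
  rw [alphaOne_cast hq]
  linarith [Int.le_ceil q]

theorem one_le_alphaOne_div (hq : 1 < q) : 1 ≤ (alphaOne q : ℝ) / (q - 1) := by
  rw [le_div_iff₀ (by linarith)]
  linarith [le_alphaOne_add_one hq]

theorem hasSum_digit_bound (hq : 1 < q) (A : ℝ) :
    HasSum (fun i : ℕ => A / q ^ (i + 1)) (A / (q - 1)) := by
  have h0 : q ≠ 0 := by linarith
  have h1 : q - 1 ≠ 0 := by linarith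
  have h := (hasSum_geometric_of_lt_one (r := q⁻¹) (by positivity)
    (inv_lt_one_of_one_lt₀ hq)).mul_left (A / q)
  have he : A / q * (1 - q⁻¹)⁻¹ = A / (q - 1) := by
    have : 1 - q⁻¹ = (q - 1) / q := by field_simp
    rw [this]
    field_simp
  rw [he] at h
  refine h.congr_fun fun i => ?_
  rw [pow_succ, inv_pow]
  field_simp

theorem digit_div_nonneg (hq : 1 < q) (c : ℕ → ℕ) (i : ℕ) : 0 ≤ (c i : ℝ) / q ^ (i + 1) := by
  have : 0 < q := by linarith
  positivity

theorem digit_div_le (hq : 1 < q) {A : ℕ} {c : ℕ → ℕ} (hc : ∀ i, c i ≤ A) (i : ℕ) :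
    (c i : ℝ) / q ^ (i + 1) ≤ A / q ^ (i + 1) := by
  have : 0 < q := by linarith
  have : (c i : ℝ) ≤ A := by exact_mod_cast hc i
  gcongr

theorem summable_digits (hq : 1 < q) {A : ℕ} {c : ℕ → ℕ} (hc : ∀ i, c i ≤ A) :
    Summable fun i => (c i : ℝ) / q ^ (i + 1) :=
  Summable.of_nonneg_of_le (digit_div_nonneg hq c) (digit_div_le hq hc)
    (hasSum_digit_bound hq A).summable

theorem seqValue_nonneg (hq : 1 < q) (c : ℕ → ℕ) : 0 ≤ seqValue q c :=
  tsum_nonneg (digit_div_nonneg hq c)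

theorem seqValue_le (hq : 1 < q) {A : ℕ} {c : ℕ → ℕ} (hc : ∀ i, c i ≤ A) :
    seqValue q c ≤ A / (q - 1) := by
  rw [← (hasSum_digit_bound hq A).tsum_eq]
  exact (summable_digits hq hc).tsum_le_tsum (digit_div_le hq hc) (hasSum_digit_bound hq A).summable

theorem seqValue_pos_of_infinite (hq : 1 < q) {A : ℕ} {c : ℕ → ℕ} (hc : ∀ i, c i ≤ A)
    (hinf : InfiniteSeq c) (n : ℕ) : 0 < seqValue q (shiftSeq n c) := by
  obtain ⟨m, hm, hnm⟩ := hinf.exists_gt n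
  have hs : ∀ i, shiftSeq n c i ≤ A := fun i => hc _
  refine (summable_digits hq hs).tsum_pos (digit_div_nonneg hq _) (m - n) ?_
  have hq0 : 0 < q := by linarith
  have : shiftSeq n c (m - n) = c m := by
    simp only [shiftSeq]
    congr 1
    omega
  rw [this]
  have : 0 < c m := Nat.pos_of_ne_zero hm
  positivity

theorem infiniteSeq_of_seqValue_pos {c : ℕ → ℕ} (h : ∀ n, 0 < seqValue q (shiftSeq n c)) :
    InfiniteSeq c := by
  intro hfin
  obtain ⟨N, hN⟩ := hfin.bddAbove
  have hz : ∀ i, shiftSeq (N + 1) c i = 0 := by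
    intro i
    by_contra hne
    have := hN (show N + 1 + i ∈ {i | c i ≠ 0} from hne)
    omega
  have := h (N + 1)
  simp [seqValue, hz] at this

theorem seqValue_eq (hq : 1 < q) {A : ℕ} {c : ℕ → ℕ} (hc : ∀ i, c i ≤ A) (n : ℕ) :
    seqValue q c = ∑ i ∈ Finset.range n, (c i : ℝ) / q ^ (i + 1)
      + seqValue q (shiftSeq n c) / q ^ n := by
  have hq0 : q ≠ 0 := by linarith
  rw [seqValue, ← (summable_digits hq hc).sum_add_tsum_nat_add n, seqValue, ← tsum_div_const]
  congr 1
  refine tsum_congr fun i => ?_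
  rw [shiftSeq, add_comm i n, div_div, ← pow_add]
  congr 2
  omega

theorem seqValue_sub_seqValue (hq : 1 < q) {A : ℕ} {a c : ℕ → ℕ} (ha : ∀ i, a i ≤ A)
    (hc : ∀ i, c i ≤ A) {n : ℕ} (h : ∀ i < n, a i = c i) :
    seqValue q c - seqValue q a = ((c n : ℝ) - a n + seqValue q (shiftSeq (n + 1) c)
      - seqValue q (shiftSeq (n + 1) a)) / q ^ (n + 1) := by
  have hsum : ∑ i ∈ Finset.range n, (a i : ℝ) / q ^ (i + 1)
      = ∑ i ∈ Finset.range n, (c i : ℝ) / q ^ (i + 1) :=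
    Finset.sum_congr rfl fun i hi => by rw [h i (Finset.mem_range.1 hi)]
  rw [seqValue_eq hq ha (n + 1), seqValue_eq hq hc (n + 1), Finset.sum_range_succ,
    Finset.sum_range_succ, hsum]
  ring

theorem seqValue_lt_of_lexLt (hq : 1 < q) {A : ℕ} {b c : ℕ → ℕ} (hb : ∀ i, b i ≤ A)
    (hc : ∀ i, c i ≤ A) (hG : ∀ n, b n < A → seqValue q (shiftSeq (n + 1) b) < 1)
    (h : LexLt b c) : seqValue q b < seqValue q c := by
  obtain ⟨n, hn, hlt⟩ := h
  rw [← sub_pos, seqValue_sub_seqValue hq hb hc hn]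
  have h1 := hG n (hlt.trans_le (hc n))
  have h2 := seqValue_nonneg hq (shiftSeq (n + 1) c)
  have h3 : (b n : ℝ) + 1 ≤ c n := by exact_mod_cast hlt
  have hq0 : 0 < q := by linarith
  apply div_pos _ (by positivity)
  linarith

theorem seqValue_le_of_lexLt (hq : 1 < q) {A : ℕ} {a c : ℕ → ℕ} (ha : ∀ i, a i ≤ A)
    (hc : ∀ i, c i ≤ A) (hQ : ∀ n, a n < A → seqValue q (shiftSeq (n + 1) a) ≤ 1)
    (h : LexLt a c) : seqValue q a ≤ seqValue q c := by
  obtain ⟨n, hn, hlt⟩ := h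
  rw [← sub_nonneg, seqValue_sub_seqValue hq ha hc hn]
  have h1 := hQ n (hlt.trans_le (hc n))
  have h2 := seqValue_nonneg hq (shiftSeq (n + 1) c)
  have h3 : (a n : ℝ) + 1 ≤ c n := by exact_mod_cast hlt
  have hq0 : 0 < q := by linarith
  apply div_nonneg _ (by positivity)
  linarith

theorem seqValue_lt_of_lexLt_of_infinite (hq : 1 < q) {A : ℕ} {a c : ℕ → ℕ} (ha : ∀ i, a i ≤ A)
    (hc : ∀ i, c i ≤ A) (hQ : ∀ n, a n < A → seqValue q (shiftSeq (n + 1) a) ≤ 1)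
    (hinf : InfiniteSeq c) (h : LexLt a c) : seqValue q a < seqValue q c := by
  obtain ⟨n, hn, hlt⟩ := h
  rw [← sub_pos, seqValue_sub_seqValue hq ha hc hn]
  have h1 := hQ n (hlt.trans_le (hc n))
  have h2 := seqValue_pos_of_infinite hq hc hinf (n + 1)
  have h3 : (a n : ℝ) + 1 ≤ c n := by exact_mod_cast hlt
  have hq0 : 0 < q := by linarith
  apply div_pos _ (by positivity)
  linarith

theorem seqValue_eq_of_remainders (hq : 1 < q) {A : ℕ} {c : ℕ → ℕ} (hc : ∀ i, c i ≤ A)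
    {r : ℕ → ℝ} {M : ℝ} (hr0 : ∀ n, 0 ≤ r n) (hrM : ∀ n, r n ≤ M)
    (hr : ∀ n, r (n + 1) = q * r n - c n) : seqValue q c = r 0 := by
  have hq0 : 0 < q := by linarith
  have hpart : ∀ n, ∑ i ∈ Finset.range n, (c i : ℝ) / q ^ (i + 1) = r 0 - r n / q ^ n := by
    intro n
    induction n with
    | zero => simp
    | succ n ih =>
      rw [Finset.sum_range_succ, ih, hr]
      field_simp
      ring
  have hlim : Filter.Tendsto (fun n => r n / q ^ n) Filter.atTop (nhds 0) := by
    have hM : Filter.Tendsto (fun n : ℕ => M * (q⁻¹) ^ n) Filter.atTop (nhds 0) := by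
      simpa using (tendsto_pow_atTop_nhds_zero_of_lt_one (r := q⁻¹) (by positivity)
        (inv_lt_one_of_one_lt₀ hq)).const_mul M
    refine squeeze_zero (fun n => div_nonneg (hr0 n) (by positivity)) (fun n => ?_) hM
    rw [inv_pow, ← div_eq_mul_inv]
    exact div_le_div_of_nonneg_right (hrM n) (by positivity)
  have h1 := (summable_digits hq hc).hasSum.tendsto_sum_nat
  simp only [hpart] at h1
  have h2 := hlim.const_sub (r 0)
  rw [sub_zero] at h2
  exact tendsto_nhds_unique h1 h2

/-- A digit choice `d` that keeps the remainder `q * x - d x` inside a bounded set `S` of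
nonnegative reals produces expansions of the elements of `S`. -/
theorem exists_digits_of_invariant (hq : 1 < q) {A : ℕ} {S : Set ℝ} {M : ℝ}
    (hS : ∀ x ∈ S, 0 ≤ x ∧ x ≤ M) (d : ℝ → ℕ) (hdA : ∀ x, d x ≤ A)
    (hd : ∀ x ∈ S, q * x - d x ∈ S) {x : ℝ} (hx : x ∈ S) :
    ∃ c : ℕ → ℕ, (∀ i, c i ≤ A) ∧ seqValue q c = x ∧
      ∀ n, ∃ y ∈ S, seqValue q (shiftSeq n c) = y ∧ c n = d y ∧
        seqValue q (shiftSeq (n + 1) c) = q * y - d y := by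
  set T : ℝ → ℝ := fun y => q * y - d y with hT
  have hmem : ∀ n, T^[n] x ∈ S := by
    intro n
    induction n with
    | zero => exact hx
    | succ n ih =>
      rw [Function.iterate_succ_apply']
      exact hd _ ih
  have hval : ∀ n, seqValue q (shiftSeq n fun i => d (T^[i] x)) = T^[n] x := by
    intro n
    refine seqValue_eq_of_remainders hq (A := A) (fun i => hdA _) (r := fun i => T^[n + i] x)
      (fun i => (hS _ (hmem _)).1) (fun i => (hS _ (hmem _)).2) fun i => ?_
    show T^[n + i + 1] x = _
    rw [Function.iterate_succ_apply']
  refine ⟨fun i => d (T^[i] x), fun i => hdA _, ?_, fun n => ⟨T^[n] x, hmem n, hval n, rfl, ?_⟩⟩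
  · have h0 : shiftSeq 0 (fun i => d (T^[i] x)) = fun i => d (T^[i] x) := by
      funext i
      simp [shiftSeq]
    have h := hval 0
    rw [h0] at h
    exact h
  · rw [hval, Function.iterate_succ_apply']

theorem exists_greedy_digits (hq : 1 < q) {x : ℝ} (hx : x ∈ Jq q) :
    ∃ b : ℕ → ℕ, (∀ i, b i ≤ alphaOne q) ∧ seqValue q b = x ∧
      ∀ n, b n < alphaOne q → seqValue q (shiftSeq (n + 1) b) < 1 := by
  have hq0 : 0 < q := by linarith
  have hinv : ∀ y ∈ Jq q, q * y - (min (alphaOne q) ⌊q * y⌋₊ : ℕ) ∈ Jq q := by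
    rintro y ⟨hy0, hyM⟩
    have hqy : 0 ≤ q * y := by positivity
    have hfl := Nat.floor_le hqy
    rcases le_total (alphaOne q) ⌊q * y⌋₊ with h | h
    · rw [min_eq_left h]
      have h' : (alphaOne q : ℝ) ≤ ⌊q * y⌋₊ := by exact_mod_cast h
      refine ⟨by linarith, ?_⟩
      have h1 : (0 : ℝ) < q - 1 := by linarith
      rw [le_div_iff₀ h1] at hyM ⊢
      nlinarith
    · rw [min_eq_right h]
      have := Nat.lt_floor_add_one (q * y)
      exact ⟨by linarith, by linarith [one_le_alphaOne_div hq]⟩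
  obtain ⟨b, hb, hbx, hbd⟩ := exists_digits_of_invariant hq (A := alphaOne q) (S := Jq q)
    (M := alphaOne q / (q - 1)) (fun x hx => hx) (fun y => min (alphaOne q) ⌊q * y⌋₊)
    (fun y => min_le_left _ _) hinv hx
  refine ⟨b, hb, hbx, fun n hn => ?_⟩
  obtain ⟨y, -, -, hby, hval⟩ := hbd n
  rw [hby] at hn
  have hmin : min (alphaOne q) ⌊q * y⌋₊ = ⌊q * y⌋₊ := by omega
  rw [hval, hmin]
  linarith [Nat.lt_floor_add_one (q * y)]

theorem exists_quasiGreedy_digits (hq : 1 < q) {x : ℝ} (hx0 : 0 < x) (hx : x ∈ Jq q) :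
    ∃ a : ℕ → ℕ, (∀ i, a i ≤ alphaOne q) ∧ seqValue q a = x ∧
      (∀ n, 0 < seqValue q (shiftSeq n a)) ∧
      ∀ n, a n < alphaOne q → seqValue q (shiftSeq (n + 1) a) ≤ 1 := by
  have hq0 : 0 < q := by linarith
  have hceil : ∀ y : ℝ, 0 < y → ((⌈q * y⌉₊ - 1 : ℕ) : ℝ) = ⌈q * y⌉₊ - 1 := fun y hy => by
    have : 1 ≤ ⌈q * y⌉₊ := Nat.one_le_ceil_iff.2 (by positivity)
    push_cast [this]
    rfl
  have hinv : ∀ y ∈ Set.Ioc 0 ((alphaOne q : ℝ) / (q - 1)),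
      q * y - (min (alphaOne q) (⌈q * y⌉₊ - 1) : ℕ) ∈ Set.Ioc 0 ((alphaOne q : ℝ) / (q - 1)) := by
    rintro y ⟨hy0, hyM⟩
    have hqy : 0 ≤ q * y := by positivity
    have hlt := Nat.ceil_lt_add_one hqy
    rcases le_total (alphaOne q) (⌈q * y⌉₊ - 1) with h | h
    · rw [min_eq_left h]
      have h' : (alphaOne q : ℝ) ≤ (⌈q * y⌉₊ - 1 : ℕ) := by exact_mod_cast h
      rw [hceil y hy0] at h'
      refine ⟨by linarith, ?_⟩
      have h1 : (0 : ℝ) < q - 1 := by linarith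
      rw [le_div_iff₀ h1] at hyM ⊢
      nlinarith
    · rw [min_eq_right h, hceil y hy0]
      have := Nat.le_ceil (q * y)
      exact ⟨by linarith, by linarith [one_le_alphaOne_div hq]⟩
  obtain ⟨a, ha, hax, had⟩ := exists_digits_of_invariant hq (A := alphaOne q)
    (S := Set.Ioc 0 (alphaOne q / (q - 1)))
    (M := alphaOne q / (q - 1)) (fun x hx => ⟨hx.1.le, hx.2⟩)
    (fun y => min (alphaOne q) (⌈q * y⌉₊ - 1)) (fun y => min_le_left _ _) hinv ⟨hx0, hx.2⟩
  refine ⟨a, ha, hax, fun n => ?_, fun n hn => ?_⟩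
  · obtain ⟨y, hy, hval, -⟩ := had n
    rw [hval]
    exact hy.1
  · obtain ⟨y, hy, -, hay, hval⟩ := had n
    rw [hay] at hn
    have hmin : min (alphaOne q) (⌈q * y⌉₊ - 1) = ⌈q * y⌉₊ - 1 := by omega
    rw [hval, hmin, hceil y hy.1]
    linarith [Nat.le_ceil (q * y)]

theorem greedy_eq {x : ℝ} {b : ℕ → ℕ} (hb : IsGreedyOf q x b) : greedy q x = b := by
  have h : ∃ b, IsGreedyOf q x b := ⟨b, hb⟩
  rw [greedy, dif_pos h]
  exact (hb.2 _ h.choose_spec.1).antisymm (h.choose_spec.2 _ hb.1)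

theorem quasiGreedy_eq {x : ℝ} {a : ℕ → ℕ} (ha : IsQuasiGreedyOf q x a) :
    quasiGreedy q x = a := by
  have h : ∃ a, IsQuasiGreedyOf q x a := ⟨a, ha⟩
  rw [quasiGreedy, dif_pos h]
  exact (ha.2.2 _ h.choose_spec.1 h.choose_spec.2.1).antisymm
    (h.choose_spec.2.2 _ ha.1 ha.2.1)

theorem greedy_seqValue (hq : 1 < q) {b : ℕ → ℕ} (hb : ∀ i, b i ≤ alphaOne q)
    (hG : ∀ n, b n < alphaOne q → seqValue q (shiftSeq (n + 1) b) < 1) :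
    greedy q (seqValue q b) = b := by
  refine greedy_eq ⟨⟨hb, rfl⟩, fun c hc => ?_⟩
  rcases lexLt_trichotomy c b with h | h | h
  · exact Or.inl h
  · exact Or.inr h
  · exact absurd hc.2 (seqValue_lt_of_lexLt hq hb hc.1 hG h).ne

theorem greedy_spec (hq : 1 < q) {x : ℝ} (hx : x ∈ Jq q) :
    (∀ i, greedy q x i ≤ alphaOne q) ∧ seqValue q (greedy q x) = x ∧
      ∀ n, greedy q x n < alphaOne q → seqValue q (shiftSeq (n + 1) (greedy q x)) < 1 := by
  obtain ⟨b, hb, rfl, hG⟩ := exists_greedy_digits hq hx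
  rw [greedy_seqValue hq hb hG]
  exact ⟨hb, rfl, hG⟩

theorem quasiGreedy_spec (hq : 1 < q) {x : ℝ} (hx0 : 0 < x) (hx : x ∈ Jq q) :
    (∀ i, quasiGreedy q x i ≤ alphaOne q) ∧ seqValue q (quasiGreedy q x) = x ∧
      (∀ n, 0 < seqValue q (shiftSeq n (quasiGreedy q x))) ∧
      ∀ n, quasiGreedy q x n < alphaOne q →
        seqValue q (shiftSeq (n + 1) (quasiGreedy q x)) ≤ 1 := by
  obtain ⟨a, ha, rfl, hpos, hQ⟩ := exists_quasiGreedy_digits hq hx0 hx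
  have : quasiGreedy q (seqValue q a) = a := by
    refine quasiGreedy_eq ⟨⟨ha, rfl⟩, infiniteSeq_of_seqValue_pos hpos, fun c hc hinf => ?_⟩
    rcases lexLt_trichotomy c a with h | h | h
    · exact Or.inl h
    · exact Or.inr h
    · exact absurd hc.2 (seqValue_lt_of_lexLt_of_infinite hq ha hc.1 hQ hinf h).ne
  rw [this]
  exact ⟨ha, rfl, hpos, hQ⟩

theorem one_mem_Jq (hq : 1 < q) : (1 : ℝ) ∈ Jq q := ⟨zero_le_one, one_le_alphaOne_div hq⟩

theorem lexLt_quasiGreedy_one (hq : 1 < q) {c : ℕ → ℕ} (hc : ∀ i, c i ≤ alphaOne q)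
    (h : seqValue q c < 1) : LexLt c (quasiGreedy q 1) := by
  obtain ⟨ha, hval, -, hQ⟩ := quasiGreedy_spec hq one_pos (one_mem_Jq hq)
  rcases lexLt_trichotomy c (quasiGreedy q 1) with hlt | heq | hlt
  · exact hlt
  · rw [heq, hval] at h
    exact (lt_irrefl _ h).elim
  · have := seqValue_le_of_lexLt hq ha hc hQ hlt
    linarith

theorem seqValue_shiftSeq_lt_one (hq : 1 < q) {b : ℕ → ℕ} (hb : ∀ i, b i ≤ alphaOne q)
    (h : ∀ n, b n < alphaOne q → LexLt (shiftSeq (n + 1) b) (quasiGreedy q 1)) (n : ℕ)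
    (hn : b n < alphaOne q) : seqValue q (shiftSeq (n + 1) b) < 1 := by
  have hq0 : 0 < q := by linarith
  obtain ⟨ha, hval, hpos, -⟩ := quasiGreedy_spec hq one_pos (one_mem_Jq hq)
  have hstep : ∀ n, b n < alphaOne q → ∃ m k, b m < alphaOne q ∧
      seqValue q (shiftSeq (n + 1) b) - 1
        < (seqValue q (shiftSeq (m + 1) b) - 1) / q ^ (k + 1) := by
    intro n hn
    obtain ⟨k, hk, hlt⟩ := h n hn
    refine ⟨n + 1 + k, k, hlt.trans_le (ha k), ?_⟩
    have hsub := seqValue_sub_seqValue hq (a := shiftSeq (n + 1) b) (fun i => hb _) ha hk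
    rw [hval, shiftSeq_shiftSeq, ← add_assoc] at hsub
    have h3 : (shiftSeq (n + 1) b k : ℝ) + 1 ≤ quasiGreedy q 1 k := by exact_mod_cast hlt
    rw [← neg_lt_neg_iff, neg_sub, hsub, ← neg_div]
    apply div_lt_div_of_pos_right _ (by positivity)
    linarith [hpos (k + 1)]
  set B : ℝ := alphaOne q / (q - 1) with hB
  have hB0 : 0 ≤ B := zero_le_one.trans (one_le_alphaOne_div hq)
  have hbound : ∀ j : ℕ, ∀ n, b n < alphaOne q →
      seqValue q (shiftSeq (n + 1) b) - 1 ≤ B * q⁻¹ ^ j := by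
    intro j
    induction j with
    | zero =>
      intro n _
      have := seqValue_le hq (c := shiftSeq (n + 1) b) fun i => hb _
      rw [pow_zero, mul_one]
      linarith
    | succ j ih =>
      intro n hn
      obtain ⟨m, k, hm, hlt⟩ := hstep n hn
      calc seqValue q (shiftSeq (n + 1) b) - 1
          ≤ (seqValue q (shiftSeq (m + 1) b) - 1) / q ^ (k + 1) := hlt.le
        _ ≤ B * q⁻¹ ^ j / q ^ (k + 1) := div_le_div_of_nonneg_right (ih m hm) (by positivity)
        _ ≤ B * q⁻¹ ^ j / q := div_le_div_of_nonneg_left (by positivity) hq0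
            (le_self_pow₀ hq.le (Nat.succ_ne_zero k))
        _ = B * q⁻¹ ^ (j + 1) := by rw [pow_succ, div_eq_mul_inv, mul_assoc]
  have hle : ∀ n, b n < alphaOne q → seqValue q (shiftSeq (n + 1) b) - 1 ≤ 0 := by
    intro n hn
    have hlim := (tendsto_pow_atTop_nhds_zero_of_lt_one (r := q⁻¹) (by positivity)
      (inv_lt_one_of_one_lt₀ hq)).const_mul B
    rw [mul_zero] at hlim
    exact ge_of_tendsto' hlim fun j => hbound j n hn
  obtain ⟨m, k, hm, hlt⟩ := hstep n hn
  have := div_nonpos_of_nonpos_of_nonneg (hle m hm) (by positivity : (0 : ℝ) ≤ q ^ (k + 1))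
  linarith

end Digits

/-- For fixed `q > 1`, the map `x ↦ (b_i(x))` is a strictly
increasing bijection from `J_q` onto the set of sequences with digits `≤ α₁` all of
whose shifts after a digit `< α₁` are lexicographically smaller than `(α_i(q))`. -/
theorem greedy_strictMono_bijective (q : ℝ) (hq : 1 < q) :
    (∀ x y : ℝ, x ∈ Jq q → y ∈ Jq q → x < y → LexLt (greedy q x) (greedy q y)) ∧
    (∀ x ∈ Jq q, (∀ n, greedy q x n ≤ alphaOne q) ∧
      ∀ n, greedy q x n < alphaOne q →
        LexLt (fun i => greedy q x (n + 1 + i)) (quasiGreedy q 1)) ∧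
    (∀ b : ℕ → ℕ, (∀ n, b n ≤ alphaOne q) →
      (∀ n, b n < alphaOne q → LexLt (fun i => b (n + 1 + i)) (quasiGreedy q 1)) →
      ∃ x ∈ Jq q, greedy q x = b) := by
  refine ⟨fun x y hx hy hxy => ?_, fun x hx => ?_, fun b hb h => ?_⟩
  · obtain ⟨hx1, hx2, -⟩ := greedy_spec hq hx
    obtain ⟨hy1, hy2, hy3⟩ := greedy_spec hq hy
    rcases lexLt_trichotomy (greedy q x) (greedy q y) with h | h | h
    · exact h
    · rw [h, hy2] at hx2
      exact absurd hx2 hxy.ne'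
    · have := seqValue_lt_of_lexLt hq hy1 hx1 hy3 h
      linarith
  · obtain ⟨hx1, -, hx3⟩ := greedy_spec hq hx
    exact ⟨hx1, fun n hn => lexLt_quasiGreedy_one hq (fun i => hx1 _) (hx3 n hn)⟩
  · exact ⟨seqValue q b, ⟨seqValue_nonneg hq b, seqValue_le hq hb⟩,
      greedy_seqValue hq hb (seqValue_shiftSeq_lt_one hq hb h)⟩
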